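/- arXiv:2208.03152 — 3 statements merged into one kernel-verified Lean document; each statement's English description precedes it below -/
import Mathlib

section
/- For every finite alphabet A, every finite set C of colors, and every coloring f : FIN_A → C, there exists an infinite block sequence X ⊆ FIN_{A⋆} such that [X]_A is f-homogeneous. -/
namespace Carlson

/-- The domain of a partial function `ℕ →. B`, encoded as `ℕ → Option B`. -/
def dom {B : Type*} (p : ℕ → Option B) : Set ℕ := {n | p n ≠ none}

/-- `p` is a located word over `B`: a partial function with finite nonempty domain. -/
def IsLW {B : Type*} (p : ℕ → Option B) : Prop := (dom p).Finite ∧ (dom p).Nonempty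

/-- A located variable word over `A` is a located word over `Option A`
(where `none` encodes the variable `⋆`) taking the value `⋆` at least once. -/
def IsLVW {A : Type*} (p : ℕ → Option (Option A)) : Prop :=
  IsLW p ∧ ∃ n, p n = some none

/-- `p < q`: every element of the domain of `p` is below every element of the domain of `q`. -/
def blt {B : Type*} (p q : ℕ → Option B) : Prop :=
  ∀ m ∈ dom p, ∀ n ∈ dom q, m < n

/-- Union `p ∪ q` of two partial functions (`p` takes precedence; for `blt p q`
the domains are disjoint, so this is the genuine union). -/
def pun {B : Type*} (p q : ℕ → Option B) : ℕ → Option B :=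
  fun n => (p n).elim (q n) some

/-- The empty partial function. -/
def emptyW {B : Type*} : ℕ → Option B := fun _ => none

/-- `p[a]`: substitution of the letter `a ∈ A` for the variable `⋆` in a located
variable word. -/
def substA {A : Type*} (p : ℕ → Option (Option A)) (a : A) : ℕ → Option A :=
  fun n => (p n).map fun x => x.getD a

/-- `p[a]` for `a ∈ A ∪ {⋆}` (with `none` encoding `⋆`, so `p[⋆] = p`). -/
def substV {A : Type*} (p : ℕ → Option (Option A)) (a : Option A) : ℕ → Option (Option A) :=
  fun n => (p n).map fun x => x.elim a some

/-- Union of a finite family of partial functions with pairwise disjoint domains. -/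
def famUnion {B : Type*} {k : ℕ} (g : Fin k → ℕ → Option B) : ℕ → Option B :=
  fun n => ((List.ofFn fun i => g i n).filterMap id).head?

/-- A block sequence: a set of located variable words totally ordered by `<`. -/
def IsBlockSeq {A : Type*} (X : Set (ℕ → Option (Option A))) : Prop :=
  (∀ p ∈ X, IsLVW p) ∧ ∀ p ∈ X, ∀ q ∈ X, p = q ∨ blt p q ∨ blt q p

/-- `[X]_A`: located words of the form `p₀[a₀] ∪ ⋯ ∪ p_k[a_k]` with `p₀ < ⋯ < p_k`
all in `X` and `a₀, …, a_k ∈ A`. -/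
def combA {A : Type*} (X : Set (ℕ → Option (Option A))) : Set (ℕ → Option A) :=
  { q | ∃ (k : ℕ) (p : Fin (k + 1) → ℕ → Option (Option A)) (a : Fin (k + 1) → A),
      (∀ i, p i ∈ X) ∧ (∀ i j : Fin (k + 1), i < j → blt (p i) (p j)) ∧
      q = famUnion fun i => substA (p i) (a i) }

/-- `[X]_{A⋆}`: located variable words of the form `p₀[a₀] ∪ ⋯ ∪ p_k[a_k]` with
`p₀ < ⋯ < p_k` all in `X`, `a₀, …, a_k ∈ A ∪ {⋆}`, and `⋆` used at least once. -/
def combV {A : Type*} (X : Set (ℕ → Option (Option A))) : Set (ℕ → Option (Option A)) :=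
  { q | ∃ (k : ℕ) (p : Fin (k + 1) → ℕ → Option (Option A)) (a : Fin (k + 1) → Option A),
      (∀ i, p i ∈ X) ∧ (∀ i j : Fin (k + 1), i < j → blt (p i) (p j)) ∧
      (∃ i, a i = none) ∧ q = famUnion fun i => substV (p i) (a i) }

/-- `X − F`: the elements of `X` whose domain lies entirely above the domains of
all members of `F`. -/
def sminus {B : Type*} (X F : Set (ℕ → Option B)) : Set (ℕ → Option B) :=
  { q ∈ X | ∀ p ∈ F, blt p q }

/-- `dom q ⊆ [0, ℓ)`. -/
def domBelow {B : Type*} (q : ℕ → Option B) (ℓ : ℕ) : Prop := ∀ n ∈ dom q, n < ℓ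

/-- `dom q ⊆ [m, ∞)`. -/
def domAbove {B : Type*} (q : ℕ → Option B) (m : ℕ) : Prop := ∀ n ∈ dom q, m ≤ n

/-- `S^ℓ_p(f) = S^ℓ_{p'}(g)` for colorings of located words: agreement at `q ∪ p`
vs `q ∪ p'` for every located word `q` with domain contained in `[0, ℓ)`.
(Take `p' = emptyW` to express `S^ℓ_p(f) = S^ℓ(g)`.) -/
def SEq {A C : Type*} (f g : (ℕ → Option A) → C) (ℓ : ℕ) (p p' : ℕ → Option A) : Prop :=
  ∀ q : ℕ → Option A, IsLW q → domBelow q ℓ → f (pun q p) = g (pun q p')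

/-- Variant of `SEq` for colorings that are also defined at the empty located word,
i.e. `q` ranges over `FIN_A(0, ℓ) ∪ {∅}`. -/
def SEq0 {A C : Type*} (f g : (ℕ → Option A) → C) (ℓ : ℕ) (p p' : ℕ → Option A) : Prop :=
  ∀ q : ℕ → Option A, (dom q).Finite → domBelow q ℓ → f (pun q p) = g (pun q p')

/-- A coloring `f` is recurrent if for every `ℓ` there is a located variable word `p`
with domain in `[ℓ, ∞)` such that `S^ℓ_{p[a]}(f) = S^ℓ(f)` for every `a ∈ A`. -/
def Recurrent {A C : Type*} (f : (ℕ → Option A) → C) : Prop :=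
  ∀ ℓ : ℕ, ∃ p : ℕ → Option (Option A), IsLVW p ∧ domAbove p ℓ ∧
    ∀ a : A, SEq f f ℓ (substA p a) emptyW

/-- A coloring `f` is uniformly recurrent if for every `ℓ` there is `m > ℓ` such that
for every `p ∈ FIN_A(m, ∞)` there is `q ∈ FIN_A(ℓ, m)` with `S^ℓ_{q ∪ p}(f) = S^ℓ(f)`. -/
def UnifRecurrent {A C : Type*} (f : (ℕ → Option A) → C) : Prop :=
  ∀ ℓ : ℕ, ∃ m : ℕ, ℓ < m ∧ ∀ p : ℕ → Option A, IsLW p → domAbove p m →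
    ∃ q : ℕ → Option A, IsLW q ∧ domAbove q ℓ ∧ domBelow q m ∧
      SEq f f ℓ (pun q p) emptyW

/-- `f` and `g` are weakly proximal: for every `ℓ` there is `p ∈ FIN_A(ℓ, ∞)` with
`S^ℓ_p(f) = S^ℓ_p(g)`. -/
def WeakProx {A C : Type*} (f g : (ℕ → Option A) → C) : Prop :=
  ∀ ℓ : ℕ, ∃ p : ℕ → Option A, IsLW p ∧ domAbove p ℓ ∧ SEq f g ℓ p p

/-- `g` is strongly proximal to `f`: for every `ℓ` there is a located variable word `p`
with domain in `[ℓ, ∞)` such that `S^ℓ(g) = S^ℓ_{p[a]}(g) = S^ℓ_{p[a]}(f)` for all `a ∈ A`. -/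
def StrongProx {A C : Type*} (g f : (ℕ → Option A) → C) : Prop :=
  ∀ ℓ : ℕ, ∃ p : ℕ → Option (Option A), IsLVW p ∧ domAbove p ℓ ∧
    ∀ a : A, SEq g g ℓ emptyW (substA p a) ∧ SEq g f ℓ (substA p a) (substA p a)

/-- `Recurrent` for colorings also defined at the empty located word. -/
def Recurrent0 {A C : Type*} (f : (ℕ → Option A) → C) : Prop :=
  ∀ ℓ : ℕ, ∃ p : ℕ → Option (Option A), IsLVW p ∧ domAbove p ℓ ∧
    ∀ a : A, SEq0 f f ℓ (substA p a) emptyW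

/-- `StrongProx` for colorings also defined at the empty located word. -/
def StrongProx0 {A C : Type*} (g f : (ℕ → Option A) → C) : Prop :=
  ∀ ℓ : ℕ, ∃ p : ℕ → Option (Option A), IsLVW p ∧ domAbove p ℓ ∧
    ∀ a : A, SEq0 g g ℓ emptyW (substA p a) ∧ SEq0 g f ℓ (substA p a) (substA p a)

/-- Agreement of two colorings on all located words with domain in `[0, ℓ)`. -/
def AgreeBelow {A C : Type*} (f g : (ℕ → Option A) → C) (ℓ : ℕ) : Prop :=
  ∀ q : ℕ → Option A, IsLW q → domBelow q ℓ → f q = g q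

/-- Closedness of a class in `C^{FIN_A}` with the product topology (`C` discrete):
a class is closed iff it contains every coloring all of whose finite restrictions
(to located words with domain in `[0, ℓ)`, for each `ℓ`) are matched within the class. -/
def IsClosedColl {A C : Type*} (𝓒 : Set ((ℕ → Option A) → C)) : Prop :=
  ∀ f, (∀ ℓ : ℕ, ∃ g ∈ 𝓒, AgreeBelow f g ℓ) → f ∈ 𝓒

/-- A subshift: a nonempty closed class `𝓒 ⊆ C^{FIN_A}` such that for every `f ∈ 𝓒`,
`ℓ ∈ ℕ` and `p ∈ FIN_A(ℓ, ∞)` there is `g ∈ 𝓒` with `S^ℓ(g) = S^ℓ_p(f)`. -/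
def IsSubshift {A C : Type*} (𝓒 : Set ((ℕ → Option A) → C)) : Prop :=
  𝓒.Nonempty ∧ IsClosedColl 𝓒 ∧
    ∀ f ∈ 𝓒, ∀ ℓ : ℕ, ∀ p : ℕ → Option A, IsLW p → domAbove p ℓ →
      ∃ g ∈ 𝓒, SEq g f ℓ emptyW p

/-- A minimal subshift: no subshift is a proper subset of it. -/
def IsMinimalSubshift {A C : Type*} (𝓒 : Set ((ℕ → Option A) → C)) : Prop :=
  IsSubshift 𝓒 ∧ ∀ 𝓓 : Set ((ℕ → Option A) → C), IsSubshift 𝓓 → 𝓓 ⊆ 𝓒 → 𝓓 = 𝓒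

/-- The orbit closure of a coloring `f`: all `g` such that for every `ℓ` and every
`q ∈ FIN_A(ℓ, ∞)` there is `p ∈ FIN_A(ℓ, ∞)` with `S^ℓ_q(g) = S^ℓ_p(f)`. -/
def orbCl {A C : Type*} (f : (ℕ → Option A) → C) : Set ((ℕ → Option A) → C) :=
  { g | ∀ ℓ : ℕ, ∀ q : ℕ → Option A, IsLW q → domAbove q ℓ →
      ∃ p : ℕ → Option A, IsLW p ∧ domAbove p ℓ ∧ SEq g f ℓ q p }

/-- A variable word over `A`, encoded as a list over `Option A` with `none` = `⋆`:
the variable must occur at least once. -/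
def IsVarWord {A : Type*} (w : List (Option A)) : Prop := none ∈ w

/-- `w[a]`: replace every occurrence of the variable `⋆` by the letter `a`. -/
def substW {A : Type*} (w : List (Option A)) (a : A) : List A :=
  w.map fun x => x.getD a

/-- `⟨(w_n)_{n∈ℕ}⟩_A`: the words `w_{j₀}[a₀] ⋯ w_{j_{k-1}}[a_{k-1}]` extracted from
the sequence `(w_n)`, for `j₀ < ⋯ < j_{k-1}` and letters `a₀, …, a_{k-1} ∈ A`. -/
def extracted {A : Type*} (w : ℕ → List (Option A)) : Set (List A) :=
  { u | ∃ (k : ℕ) (j : Fin (k + 1) → ℕ) (a : Fin (k + 1) → A),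
      StrictMono j ∧ u = (List.ofFn fun i => substW (w (j i)) (a i)).flatten }

/-- A compact semigroup with continuous right translations has an idempotent which is minimal
for the usual order `f ≤ u ↔ f * u = f ∧ u * f = f` on idempotents. -/
theorem exists_minimal_idempotent {M : Type*} [Semigroup M] [TopologicalSpace M] [T2Space M]
    (hcont : ∀ r : M, Continuous (· * r)) (s : Set M) (hne : s.Nonempty) (hs : IsCompact s)
    (hmul : ∀ x ∈ s, ∀ y ∈ s, x * y ∈ s) :
    ∃ u ∈ s, u * u = u ∧ ∀ f ∈ s, f * f = f → f * u = f → u * f = f → f = u := by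
  let I : Set (Set M) :=
    {L | IsClosed L ∧ L.Nonempty ∧ L ⊆ s ∧ ∀ x ∈ s, ∀ y ∈ L, x * y ∈ L}
  have hI : ∃ L ⊆ s, Minimal (· ∈ I) L := by
    refine zorn_superset_nonempty I ?_ s ⟨hs.isClosed, hne, subset_rfl, hmul⟩
    intro c hc hchain hcne
    refine ⟨⋂₀ c, ⟨isClosed_sInter fun t ht => (hc ht).1, ?_, ?_, ?_⟩,
      fun t ht => Set.sInter_subset_of_mem ht⟩
    · rw [Set.sInter_eq_iInter]
      have := hcne.to_subtype
      refine IsCompact.nonempty_iInter_of_directed_nonempty_isCompact_isClosed _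
        (DirectedOn.directed_val (IsChain.directedOn hchain.symm))
        (fun t => (hc t.2).2.1)
        (fun t => hs.of_isClosed_subset (hc t.2).1 (hc t.2).2.2.1)
        (fun t => (hc t.2).1)
    · obtain ⟨t, ht⟩ := hcne
      exact (Set.sInter_subset_of_mem ht).trans (hc ht).2.2.1
    · intro x hx y hy t ht
      exact (hc ht).2.2.2 x hx y (hy t ht)
  obtain ⟨L, hLs, hL⟩ := hI
  obtain ⟨hLc, hLne, -, hLmul⟩ := hL.prop
  obtain ⟨u, huL, huu⟩ := exists_idempotent_in_compact_subsemigroup hcont L hLne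
    (hs.of_isClosed_subset hLc hLs) (fun x hx y hy => hLmul x (hLs hx) y hy)
  refine ⟨u, hLs huL, huu, fun f hf hff hfu huf => ?_⟩
  have hfL : f ∈ L := hfu ▸ hLmul f hf u huL
  have hsub : (· * f) '' s ⊆ L := by
    rintro _ ⟨x, hx, rfl⟩
    exact hLmul x hx f hfL
  have heq : (· * f) '' s = L := by
    refine hL.eq_of_subset ⟨(hs.image (hcont f)).isClosed, hne.image _, hsub.trans hLs, ?_⟩ hsub
    rintro x hx _ ⟨y, hy, rfl⟩
    exact ⟨x * y, hmul x hx y hy, mul_assoc _ _ _⟩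
  obtain ⟨w, -, hw⟩ := heq.symm ▸ huL
  dsimp only at hw
  rw [← huf, ← hw, mul_assoc, hff]

section Words

variable {A B : Type*}

/-- Partial functions form a semigroup under left-biased union. -/
@[reducible] def wordSemigroup : Semigroup (ℕ → Option B) where
  mul := pun
  mul_assoc p q r := by
    funext n
    change pun (pun p q) r n = pun p (pun q r) n
    unfold pun
    cases p n <;> rfl

attribute [local instance] wordSemigroup Ultrafilter.semigroup

theorem mul_eq_pun (p q : ℕ → Option B) : p * q = pun p q := rfl

theorem dom_mul (p q : ℕ → Option B) : dom (p * q) = dom p ∪ dom q := by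
  ext n
  simp only [mul_eq_pun, dom, pun, Set.mem_ofPred_eq, Set.mem_union]
  cases p n <;> simp

theorem IsLW.mul {p q : ℕ → Option B} (hp : IsLW p) (hq : IsLW q) : IsLW (p * q) := by
  unfold IsLW
  rw [dom_mul]
  exact ⟨hp.1.union hq.1, hp.2.inl⟩

theorem domAbove.mul {p q : ℕ → Option B} {n : ℕ} (hp : domAbove p n) (hq : domAbove q n) :
    domAbove (p * q) n := by
  intro m hm
  rw [dom_mul] at hm
  exact hm.elim (hp m) (hq m)

theorem IsLVW.mul {p q : ℕ → Option (Option A)} (hp : IsLVW p) (hq : IsLW q) :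
    IsLVW (p * q) := by
  obtain ⟨hp, n, hn⟩ := hp
  exact ⟨hp.mul hq, n, by simp [mul_eq_pun, pun, hn]⟩

theorem IsLVW.mul_of_blt {p q : ℕ → Option (Option A)} (hp : IsLW p) (hq : IsLVW q)
    (h : blt p q) : IsLVW (p * q) := by
  obtain ⟨hq, n, hn⟩ := hq
  refine ⟨hp.mul hq, n, ?_⟩
  have : p n = none := by
    by_contra hpn
    exact lt_irrefl n (h n hpn n (by simp [dom, hn]))
  simp [mul_eq_pun, pun, this, hn]

theorem dom_substA (p : ℕ → Option (Option A)) (a : A) : dom (substA p a) = dom p := by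
  ext n
  simp [dom, substA]

theorem IsLW.substA {p : ℕ → Option (Option A)} (hp : IsLW p) (a : A) :
    IsLW (substA p a) := by
  unfold IsLW
  rwa [dom_substA]

theorem substA_mul (p q : ℕ → Option (Option A)) (a : A) :
    substA (p * q) a = substA p a * substA q a := by
  funext n
  simp only [mul_eq_pun, substA, pun]
  cases p n <;> rfl

/-- A word over `A`, seen as a word over `A ∪ {⋆}` without occurrences of the variable. -/
def constWord (p : ℕ → Option A) : ℕ → Option (Option A) := fun n => (p n).map some

theorem dom_constWord (p : ℕ → Option A) : dom (constWord p) = dom p := by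
  ext n
  simp [dom, constWord]

theorem constWord_mul (p q : ℕ → Option A) :
    constWord (p * q) = constWord p * constWord q := by
  funext n
  simp only [mul_eq_pun, constWord, pun]
  cases p n <;> rfl

theorem substA_constWord (p : ℕ → Option A) (a : A) : substA (constWord p) a = p := by
  funext n
  simp only [substA, constWord]
  cases p n <;> rfl

theorem map_mul_ultrafilter {M N : Type*} [Semigroup M] [Semigroup N] (φ : M → N)
    (hφ : ∀ x y, φ (x * y) = φ x * φ y) (U V : Ultrafilter M) :
    (U * V).map φ = U.map φ * V.map φ := by
  refine Ultrafilter.coe_inj.mp (Filter.ext' fun p => ?_)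
  simp only [Ultrafilter.eventually_mul, Ultrafilter.coe_map, Filter.eventually_map, hφ]

/-- Ultrafilters concentrating on located words with domain arbitrarily far to the right. -/
def farWords (B : Type*) : Set (Ultrafilter (ℕ → Option B)) :=
  ⋂ n, {U | {p | IsLW p ∧ domAbove p n} ∈ U}

/-- Ultrafilters concentrating on located variable words with domain arbitrarily far to the
right. -/
def farVarWords (A : Type*) : Set (Ultrafilter (ℕ → Option (Option A))) :=
  ⋂ n, {U | {p | IsLVW p ∧ domAbove p n} ∈ U}

theorem mem_farWords {U : Ultrafilter (ℕ → Option B)} :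
    U ∈ farWords B ↔ ∀ n, ∀ᶠ p in (U : Filter (ℕ → Option B)), IsLW p ∧ domAbove p n := Set.mem_iInter

theorem mem_farVarWords {U : Ultrafilter (ℕ → Option (Option A))} :
    U ∈ farVarWords A ↔ ∀ n, ∀ᶠ p in (U : Filter (ℕ → Option (Option A))), IsLVW p ∧ domAbove p n := Set.mem_iInter

theorem isCompact_farWords : IsCompact (farWords B) :=
  (isClosed_iInter fun _ => ultrafilter_isClosed_basic _).isCompact

theorem isCompact_farVarWords : IsCompact (farVarWords A) :=
  (isClosed_iInter fun _ => ultrafilter_isClosed_basic _).isCompact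

theorem farVarWords_subset : farVarWords A ⊆ farWords (Option A) := fun _ hU =>
  mem_farWords.2 fun n => (mem_farVarWords.1 hU n).mono fun _ hp => ⟨hp.1.1, hp.2⟩

/-- The word with domain `{n}` and value `b`. -/
def letterAt (b : B) (n : ℕ) : ℕ → Option B := fun m => if m = n then some b else none

theorem dom_letterAt (b : B) (n : ℕ) : dom (letterAt b n) = {n} := by
  ext m
  simp [dom, letterAt]

theorem isLW_letterAt (b : B) (n : ℕ) : IsLW (letterAt b n) := by
  unfold IsLW
  rw [dom_letterAt]
  exact ⟨Set.finite_singleton n, Set.singleton_nonempty n⟩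

theorem domAbove_letterAt (b : B) {m n : ℕ} (h : m ≤ n) : domAbove (letterAt b n) m := by
  intro k hk
  rw [dom_letterAt] at hk
  exact h.trans_eq hk.symm

theorem eventually_hyperfilter_ge (n : ℕ) :
    ∀ᶠ m in (Filter.hyperfilter ℕ : Filter ℕ), n ≤ m :=
  Nat.hyperfilter_le_atTop (Filter.eventually_ge_atTop n)

theorem farWords_nonempty [Nonempty B] : (farWords B).Nonempty :=
  ⟨(Filter.hyperfilter ℕ).map (letterAt (Classical.arbitrary B)), mem_farWords.2 fun n =>
    (eventually_hyperfilter_ge n).mono fun m hm =>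
      ⟨isLW_letterAt _ m, domAbove_letterAt _ hm⟩⟩

theorem farVarWords_nonempty : (farVarWords A).Nonempty :=
  ⟨(Filter.hyperfilter ℕ).map (letterAt none), mem_farVarWords.2 fun n =>
    (eventually_hyperfilter_ge n).mono fun m hm =>
      ⟨⟨isLW_letterAt _ m, m, by simp [letterAt]⟩, domAbove_letterAt _ hm⟩⟩

theorem mul_mem_farWords {U V : Ultrafilter (ℕ → Option B)} (hU : U ∈ farWords B)
    (hV : V ∈ farWords B) : U * V ∈ farWords B := by
  refine mem_farWords.2 fun n => (Ultrafilter.eventually_mul _ _ _).2 ?_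
  filter_upwards [mem_farWords.1 hU n] with p hp
  filter_upwards [mem_farWords.1 hV n] with q hq
  exact ⟨hp.1.mul hq.1, hp.2.mul hq.2⟩

theorem mul_mem_farVarWords_of_left {U V : Ultrafilter (ℕ → Option (Option A))}
    (hU : U ∈ farVarWords A) (hV : V ∈ farWords (Option A)) : U * V ∈ farVarWords A := by
  refine mem_farVarWords.2 fun n => (Ultrafilter.eventually_mul _ _ _).2 ?_
  filter_upwards [mem_farVarWords.1 hU n] with p hp
  filter_upwards [mem_farWords.1 hV n] with q hq
  exact ⟨hp.1.mul hq.1, hp.2.mul hq.2⟩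

theorem eventually_blt {B' : Type*} {U : Ultrafilter (ℕ → Option B)} (hU : U ∈ farWords B)
    {p : ℕ → Option B'} (hp : IsLW p) :
    ∀ᶠ q in (U : Filter (ℕ → Option B)), ∀ m ∈ dom p, ∀ n ∈ dom q, m < n := by
  obtain ⟨N, hN⟩ := hp.1.bddAbove
  filter_upwards [mem_farWords.1 hU (N + 1)] with q hq m hm n hn
  exact Nat.lt_of_le_of_lt (hN hm) (hq.2 n hn)

theorem mul_mem_farVarWords_of_right {U V : Ultrafilter (ℕ → Option (Option A))}
    (hU : U ∈ farWords (Option A)) (hV : V ∈ farVarWords A) : U * V ∈ farVarWords A := by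
  refine mem_farVarWords.2 fun n => (Ultrafilter.eventually_mul _ _ _).2 ?_
  filter_upwards [mem_farWords.1 hU n] with p hp
  filter_upwards [mem_farVarWords.1 hV n, eventually_blt (farVarWords_subset hV) hp.1] with q hq h
  exact ⟨hq.1.mul_of_blt hp.1 h, hp.2.mul hq.2⟩

theorem map_substA_mem_farWords {V : Ultrafilter (ℕ → Option (Option A))}
    (hV : V ∈ farVarWords A) (a : A) : V.map (substA · a) ∈ farWords A :=
  mem_farWords.2 fun n => (mem_farVarWords.1 hV n).mono fun p hp =>
    ⟨hp.1.1.substA a, by simpa only [domAbove, dom_substA] using hp.2⟩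

theorem map_constWord_mem_farWords {U : Ultrafilter (ℕ → Option A)}
    (hU : U ∈ farWords A) : U.map constWord ∈ farWords (Option A) :=
  mem_farWords.2 fun n => (mem_farWords.1 hU n).mono fun p hp => by
    simpa only [IsLW, domAbove, Set.mem_preimage, Set.mem_ofPred_eq, dom_constWord] using hp

theorem map_substA_map_constWord (U : Ultrafilter (ℕ → Option A)) (a : A) :
    (U.map constWord).map (substA · a) = U := by
  rw [Ultrafilter.map_map]
  have : (substA · a) ∘ constWord = (id : (ℕ → Option A) → _) :=
    funext fun p => substA_constWord p a
  rw [this, Ultrafilter.map_id]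

/-- There is an idempotent ultrafilter on located words which, for every letter `a`, is the
image under `p ↦ p[a]` of one and the same ultrafilter on located variable words. -/
theorem exists_idempotent_eq_map_substA [Nonempty A] :
    ∃ U ∈ farWords A, U * U = U ∧ ∃ V ∈ farVarWords A, ∀ a, V.map (substA · a) = U := by
  obtain ⟨U, hU, hUU, hmin⟩ := exists_minimal_idempotent Ultrafilter.continuous_mul_left
    (farWords A) farWords_nonempty isCompact_farWords fun _ hx _ hy => mul_mem_farWords hx hy
  set W := U.map constWord with hW
  have hWmem : W ∈ farWords (Option A) := map_constWord_mem_farWords hU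
  have hWW : W * W = W := by rw [hW, ← map_mul_ultrafilter _ constWord_mul, hUU]
  obtain ⟨_, ⟨X, hX, rfl⟩, hE⟩ := exists_idempotent_in_compact_subsemigroup
    Ultrafilter.continuous_mul_left ((· * W) '' farVarWords A) (farVarWords_nonempty.image _)
    (isCompact_farVarWords.image (Ultrafilter.continuous_mul_left W)) (by
      rintro _ ⟨X, hX, rfl⟩ _ ⟨Y, hY, rfl⟩
      exact ⟨X * W * Y, mul_mem_farVarWords_of_left (mul_mem_farVarWords_of_left hX hWmem)
        (farVarWords_subset hY), mul_assoc _ _ _⟩)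
  dsimp only at hE
  set E := X * W with hEdef
  have hEmem : E ∈ farVarWords A := mul_mem_farVarWords_of_left hX hWmem
  have hEW : E * W = E := by rw [hEdef, mul_assoc, hWW]
  have hV : W * E ∈ farVarWords A := mul_mem_farVarWords_of_right hWmem hEmem
  have hVV : W * E * (W * E) = W * E := by
    rw [mul_assoc, ← mul_assoc E W E, hEW, hE]
  have hVW : W * E * W = W * E := by rw [mul_assoc, hEW]
  have hWV : W * (W * E) = W * E := by rw [← mul_assoc, hWW]
  refine ⟨U, hU, hUU, W * E, hV, fun a => ?_⟩
  have hmap := map_mul_ultrafilter (substA · a) (fun p q => substA_mul p q a)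
  have hWU : W.map (substA · a) = U := map_substA_map_constWord U a
  refine hmin _ (map_substA_mem_farWords hV a) ?_ ?_ ?_
  · rw [← hmap, hVV]
  · conv_lhs => rw [← hWU, ← hmap, hVW]
  · conv_lhs => rw [← hWU, ← hmap, hWV]

/-- Any set in a suitable idempotent ultrafilter contains a variable word all of whose instances
lie in the set and can be continued inside it. -/
theorem exists_varWord_step [Finite A] {U : Ultrafilter (ℕ → Option A)} (hU : U ∈ farWords A)
    (hUU : U * U = U) {V : Ultrafilter (ℕ → Option (Option A))} (hV : V ∈ farVarWords A)
    (hVU : ∀ a, V.map (substA · a) = U) {s : Set (ℕ → Option A)} (hs : s ∈ U) :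
    ∃ p, IsLVW p ∧ (∀ a, substA p a ∈ s) ∧
      {q | q ∈ s ∧ (∀ m ∈ dom p, ∀ n ∈ dom q, m < n) ∧ ∀ a, substA p a * q ∈ s} ∈ U := by
  have hs2 : ∀ᶠ p in U, ∀ᶠ q in U, p * q ∈ s := by
    rw [← Ultrafilter.eventually_mul U U (· ∈ s), hUU]
    exact hs
  have h1 : ∀ᶠ p in V, ∀ a, substA p a ∈ s ∧ ∀ᶠ q in U, substA p a * q ∈ s := by
    refine Filter.eventually_all.2 fun a => ?_
    have h : ∀ᶠ p in U, p ∈ s ∧ ∀ᶠ q in U, p * q ∈ s := Filter.Eventually.and hs hs2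
    have hmap : Filter.Tendsto (substA · a) V U := by
      rw [← hVU a, Ultrafilter.coe_map]
      exact Filter.tendsto_map
    exact hmap.eventually h
  obtain ⟨p, hp, hpV⟩ := (h1.and (mem_farVarWords.1 hV 0)).exists
  refine ⟨p, hpV.1, fun a => (hp a).1, ?_⟩
  filter_upwards [hs, eventually_blt hU hpV.1.1, Filter.eventually_all.2 fun a => (hp a).2]
    with q h1 h2 h3 using ⟨h1, h2, h3⟩

theorem famUnion_succ {k : ℕ} (g : Fin (k + 1) → ℕ → Option B) :
    famUnion g = g 0 * famUnion fun i => g i.succ := by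
  funext n
  simp only [famUnion, mul_eq_pun, pun, List.ofFn_succ, List.filterMap_cons, id]
  cases g 0 n <;> rfl

theorem famUnion_one (g : Fin 1 → ℕ → Option B) : famUnion g = g 0 := by
  funext n
  simp only [famUnion, List.ofFn_succ, List.ofFn_zero, List.filterMap_cons, id]
  cases g 0 n <;> rfl

theorem blt_asymm {p q : ℕ → Option B} (hp : (dom p).Nonempty) (hq : (dom q).Nonempty)
    (h : blt p q) : ¬ blt q p := fun h' =>
  let ⟨m, hm⟩ := hp
  let ⟨n, hn⟩ := hq
  lt_asymm (h m hm n hn) (h' n hn m hm)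

theorem famUnion_mem {p : ℕ → ℕ → Option (Option A)} {s : ℕ → Set (ℕ → Option A)}
    (hmem : ∀ n a, substA (p n) a ∈ s n) (hanti : Antitone s)
    (hstep : ∀ n, ∀ q ∈ s (n + 1), ∀ a, substA (p n) a * q ∈ s n) :
    ∀ (k : ℕ) (j : Fin (k + 1) → ℕ) (a : Fin (k + 1) → A), StrictMono j →
      (famUnion fun i => substA (p (j i)) (a i)) ∈ s (j 0)
  | 0, j, a, _ => by
    rw [famUnion_one]
    exact hmem _ _
  | k + 1, j, a, hj => by
    rw [famUnion_succ]
    exact hstep _ _ (hanti (Nat.succ_le_of_lt (hj (Fin.succ_pos 0)))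
      (famUnion_mem hmem hanti hstep k (fun i => j i.succ) (fun i => a i.succ)
        (hj.comp (Fin.strictMono_succ)))) _

end Words

/-- Carlson's theorem for located words: for every finite alphabet `A`, finite set of
colors `C`, and coloring `f : FIN_A → C`, there is an infinite block sequence
`X ⊆ FIN_{A⋆}` such that `[X]_A` is `f`-homogeneous. -/
theorem carlson_located_words {A C : Type*} [Fintype A] [Nonempty A] [Fintype C]
    (f : (ℕ → Option A) → C) :
    ∃ X : Set (ℕ → Option (Option A)), IsBlockSeq X ∧ X.Infinite ∧
      ∃ c : C, ∀ q ∈ combA X, f q = c := by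
  obtain ⟨U, hU, hUU, V, hV, hVU⟩ := exists_idempotent_eq_map_substA (A := A)
  obtain ⟨c, hc⟩ : ∃ c, f ⁻¹' {c} ∈ U := by
    obtain ⟨c, hc⟩ := (U.map f).eq_pure_of_finite
    exact ⟨c, Ultrafilter.mem_map.1 (hc ▸ rfl : {c} ∈ U.map f)⟩
  choose! w hw using fun s => exists_varWord_step hU hUU hV hVU (s := s)
  let next (s : Set (ℕ → Option A)) : Set (ℕ → Option A) :=
    {q | q ∈ s ∧ (∀ m ∈ dom (w s), ∀ n ∈ dom q, m < n) ∧ ∀ a, pun (substA (w s) a) q ∈ s}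
  let s (n : ℕ) : Set (ℕ → Option A) := next^[n] (f ⁻¹' {c})
  have hsucc (n : ℕ) : s (n + 1) = next (s n) := Function.iterate_succ_apply' _ _ _
  have hs (n : ℕ) : s n ∈ U := by
    induction n with
    | zero => exact hc
    | succ n ih => exact hsucc n ▸ (hw _ ih).2.2
  have hanti : Antitone s := antitone_nat_of_succ_le fun n q hq => (hsucc n ▸ hq).1
  let p (n : ℕ) := w (s n)
  have hp (n : ℕ) : IsLVW (p n) := (hw _ (hs n)).1
  have hpmem (n : ℕ) (a : A) : substA (p n) a ∈ s n := (hw _ (hs n)).2.1 a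
  have hlt {m n : ℕ} (h : m < n) : blt (p m) (p n) := by
    have hq := hanti (Nat.succ_le_of_lt h) (hpmem n (Classical.arbitrary A))
    rw [Nat.succ_eq_add_one, hsucc] at hq
    intro i hi j hj
    exact hq.2.1 i hi j (by rwa [dom_substA])
  have hlt_of {m n : ℕ} (h : blt (p m) (p n)) : m < n := by
    have hasymm := blt_asymm (hp m).1.2 (hp n).1.2 h
    rcases lt_trichotomy m n with h' | rfl | h'
    · exact h'
    · exact absurd h hasymm
    · exact absurd (hlt h') hasymm
  have hinj : Function.Injective p := by
    intro m n h
    have hnot : ¬ blt (p m) (p m) := fun h' => lt_irrefl m (hlt_of h')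
    rcases lt_trichotomy m n with h' | h' | h'
    · exact absurd (hlt h') (h ▸ hnot)
    · exact h'
    · exact absurd (hlt h') (h ▸ hnot)
  refine ⟨Set.range p, ⟨?_, ?_⟩, Set.infinite_range_of_injective hinj, c, ?_⟩
  · rintro _ ⟨n, rfl⟩
    exact hp n
  · rintro _ ⟨m, rfl⟩ _ ⟨n, rfl⟩
    rcases lt_trichotomy m n with h | rfl | h
    · exact Or.inr (Or.inl (hlt h))
    · exact Or.inl rfl
    · exact Or.inr (Or.inr (hlt h))
  · rintro _ ⟨k, r, a, hr, hblt, rfl⟩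
    choose j hj using hr
    obtain rfl : (fun i => p (j i)) = r := funext hj
    exact hanti (Nat.zero_le _) (famUnion_mem hpmem hanti
      (fun n q hq => (hsucc n ▸ hq).2.2) k j a fun x y hxy => hlt_of (hblt x y hxy))

end Carlson
end

section
/- Let X ⊆ FIN_{A⋆} be an infinite block sequence and let f : [X]_A → C be a coloring into a finite set C. Then there exists an infinite block sequence Y ⊆ [X]_{A⋆} such that [Y]_A is f-homogeneous. -/
namespace Carlson

section CompactSemigroup

variable {K : Type*} [Semigroup K] [TopologicalSpace K] [CompactSpace K] [T2Space K]

/-- A closed subsemigroup of a compact right topological semigroup contains an idempotent that is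
minimal for the order `e ≤ w ↔ w * e = e ∧ e * w = e` on idempotents. -/
theorem exists_minimal_idempotent_s1 (hc : ∀ r : K, Continuous (· * r)) (W : Set K)
    (hWc : IsClosed W) (hWn : W.Nonempty) (hWW : ∀ x ∈ W, ∀ y ∈ W, x * y ∈ W) :
    ∃ w ∈ W, w * w = w ∧ ∀ e ∈ W, e * e = e → w * e = e → e * w = e → e = w := by
  let S : Set (Set K) :=
    {L | L ⊆ W ∧ IsClosed L ∧ L.Nonempty ∧ ∀ x ∈ W, ∀ y ∈ L, x * y ∈ L}
  obtain ⟨L, hL⟩ : ∃ L, Minimal (· ∈ S) L := by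
    refine zorn_superset _ fun c hcs hch => ?_
    obtain rfl | hne := c.eq_empty_or_nonempty
    · exact ⟨W, ⟨subset_rfl, hWc, hWn, hWW⟩, by simp⟩
    refine ⟨⋂₀ c, ⟨?_, isClosed_sInter fun t ht => (hcs ht).2.1, ?_, ?_⟩,
      fun s hs => Set.sInter_subset_of_mem hs⟩
    · obtain ⟨t, ht⟩ := hne
      exact (Set.sInter_subset_of_mem ht).trans (hcs ht).1
    · rw [Set.sInter_eq_iInter]
      have := hne.coe_sort
      refine IsCompact.nonempty_iInter_of_directed_nonempty_isCompact_isClosed _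
        (DirectedOn.directed_val (IsChain.directedOn hch.symm)) (fun i => (hcs i.prop).2.2.1)
        (fun i => (hcs i.prop).2.1.isCompact) (fun i => (hcs i.prop).2.1)
    · intro x hx y hy
      rw [Set.mem_sInter] at hy ⊢
      exact fun t ht => (hcs ht).2.2.2 x hx y (hy t ht)
  obtain ⟨hLW, hLc, hLn, hLm⟩ := hL.prop
  obtain ⟨w, hwL, hw⟩ := exists_idempotent_in_compact_subsemigroup hc L hLn hLc.isCompact
    fun x hx y hy => hLm x (hLW hx) y hy
  refine ⟨w, hLW hwL, hw, fun e he hee hwe hew => ?_⟩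
  have heL : e ∈ L := hew ▸ hLm e he w hwL
  have himg : (· * e) '' W = L := by
    apply hL.eq_of_subset
    · refine ⟨?_, (hc e).isClosedMap _ hWc, hWn.image _, ?_⟩
      · rintro _ ⟨x, hx, rfl⟩
        exact hWW x hx e he
      · rintro x hx _ ⟨y, hy, rfl⟩
        exact ⟨x * y, hWW x hx y hy, mul_assoc _ _ _⟩
    · rintro _ ⟨x, hx, rfl⟩
      exact hLm x hx e heL
  obtain ⟨x, -, hxe : x * e = w⟩ := himg.symm ▸ hwL
  rw [← hwe, ← hxe, mul_assoc, hee]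

/-- If `V` is a closed two-sided ideal over the closed subsemigroup `W` and each `σ a` is a
homomorphism retracting `V ∪ W` onto `W`, then some `v ∈ V` is sent by every `σ a` to the same
idempotent of `W`. -/
theorem exists_common_idempotent_image {A : Type*} (hc : ∀ r : K, Continuous (· * r)) (W V : Set K)
    (hWc : IsClosed W) (hWn : W.Nonempty) (hVc : IsClosed V) (hVn : V.Nonempty)
    (hWW : ∀ x ∈ W, ∀ y ∈ W, x * y ∈ W) (hWV : ∀ x ∈ W, ∀ y ∈ V, x * y ∈ V)
    (hVW : ∀ x ∈ V, ∀ y ∈ W, x * y ∈ V) (hVV : ∀ x ∈ V, ∀ y ∈ V, x * y ∈ V)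
    (σ : A → K → K) (hσ : ∀ a x y, σ a (x * y) = σ a x * σ a y)
    (hσV : ∀ a, ∀ x ∈ V, σ a x ∈ W) (hσW : ∀ a, ∀ x ∈ W, σ a x = x) :
    ∃ w v : K, w ∈ W ∧ v ∈ V ∧ w * w = w ∧ ∀ a, σ a v = w := by
  obtain ⟨w, hwW, hw, hmin⟩ := exists_minimal_idempotent_s1 hc W hWc hWn hWW
  obtain ⟨_, ⟨u, hu, rfl⟩, hidem⟩ := exists_idempotent_in_compact_subsemigroup hc ((· * w) '' V)
    (hVn.image _) ((hc w).isClosedMap _ hVc).isCompact (by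
      rintro _ ⟨x, hx, rfl⟩ _ ⟨y, hy, rfl⟩
      exact ⟨x * w * y, hVV _ (hVW x hx w hwW) y hy, mul_assoc _ _ _⟩)
  have hidem : u * w * (u * w) = u * w := hidem
  have hv : w * (u * w) ∈ V := hWV w hwW _ (hVW u hu w hwW)
  have hvw : w * (u * w) * w = w * (u * w) := by simp only [mul_assoc, hw]
  have hwv : w * (w * (u * w)) = w * (u * w) := by rw [← mul_assoc, hw]
  have hvv : w * (u * w) * (w * (u * w)) = w * (u * w) := by
    rw [← mul_assoc, hvw, mul_assoc, hidem]
  refine ⟨w, w * (u * w), hwW, hv, hw, fun a => hmin _ (hσV a _ hv) ?_ ?_ ?_⟩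
  · rw [← hσ, hvv]
  · have h := hσ a w (w * (u * w))
    rw [hwv, hσW a w hwW] at h
    exact h.symm
  · have h := hσ a (w * (u * w)) w
    rw [hvw, hσW a w hwW] at h
    exact h.symm

end CompactSemigroup

section UltrafilterSemigroup

variable {S : Type*}

/-- The ultrafilters containing every set of the sequence `Z`. -/
def ultraHull (Z : ℕ → Set S) : Set (Ultrafilter S) := {U | ∀ m, Z m ∈ U}

theorem isClosed_ultraHull (Z : ℕ → Set S) : IsClosed (ultraHull Z) := by
  have : ultraHull Z = ⋂ m, {U : Ultrafilter S | Z m ∈ U} := by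
    ext U
    simp [ultraHull]
  rw [this]
  exact isClosed_iInter fun m => ultrafilter_isClosed_basic _

theorem ultraHull_nonempty {Z : ℕ → Set S} (hZ : Antitone Z) (hn : ∀ m, (Z m).Nonempty) :
    (ultraHull Z).Nonempty := by
  have : (⨅ m, Filter.principal (Z m)).NeBot := by
    refine Filter.iInf_neBot_of_directed' ?_ fun m => Filter.principal_neBot_iff.2 (hn m)
    exact directed_of_isDirected_le fun i j hij => Filter.principal_mono.2 (hZ hij)
  refine ⟨Ultrafilter.of (⨅ m, Filter.principal (Z m)), fun m => ?_⟩
  exact (Ultrafilter.of_le _).trans (iInf_le _ m) (Filter.mem_principal_self _)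

attribute [local instance] Ultrafilter.mul Ultrafilter.semigroup

theorem ultraHull_mul_mem [Semigroup S] {Z₁ Z₂ Z₃ : ℕ → Set S}
    (h : ∀ m, ∀ p ∈ Z₁ m, ∃ n, ∀ q ∈ Z₂ n, p * q ∈ Z₃ m) :
    ∀ U ∈ ultraHull Z₁, ∀ U' ∈ ultraHull Z₂, U * U' ∈ ultraHull Z₃ := by
  intro U hU U' hU' m
  change ∀ᶠ x in ((U * U' : Ultrafilter S) : Filter S), x ∈ Z₃ m
  rw [Ultrafilter.eventually_mul]
  filter_upwards [hU m] with p hp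
  obtain ⟨n, hn⟩ := h m p hp
  filter_upwards [hU' n] with q hq using hn q hq

theorem ultrafilter_map_mul [Semigroup S] (s : S → S) (hs : ∀ x y, s (x * y) = s x * s y)
    (U U' : Ultrafilter S) : (U * U').map s = U.map s * U'.map s := by
  refine Ultrafilter.coe_inj.mp (Filter.ext' fun p => ?_)
  rw [Ultrafilter.eventually_mul, Ultrafilter.coe_map, Filter.eventually_map,
    Ultrafilter.eventually_mul]
  simp only [Ultrafilter.coe_map, Filter.eventually_map, hs]

/-- In the situation of `exists_common_idempotent_image`, every finite coloring of `S` admits a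
sequence `p` in the ideal, moving as fast as prescribed by `N`, and a decreasing sequence of
monochromatic sets `D` absorbing the products of the substitutions of `p`. -/
theorem exists_absorbing_sequence [Semigroup S] {A C : Type*} [Finite A] [Finite C]
    (W V : ℕ → Set S) (hWa : Antitone W) (hVa : Antitone V)
    (hWn : ∀ m, (W m).Nonempty) (hVn : ∀ m, (V m).Nonempty)
    (hWW : ∀ m, ∀ p ∈ W m, ∃ n, ∀ q ∈ W n, p * q ∈ W m)
    (hWV : ∀ m, ∀ p ∈ W m, ∃ n, ∀ q ∈ V n, p * q ∈ V m)
    (hVW : ∀ m, ∀ p ∈ V m, ∃ n, ∀ q ∈ W n, p * q ∈ V m)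
    (hVV : ∀ m, ∀ p ∈ V m, ∃ n, ∀ q ∈ V n, p * q ∈ V m)
    (σ : A → S → S) (hσ : ∀ a x y, σ a (x * y) = σ a x * σ a y)
    (hσV : ∀ a m, ∀ x ∈ V m, σ a x ∈ W m) (hσW : ∀ a, ∀ x ∈ W 0, σ a x = x)
    (g : S → C) (N : S → ℕ) :
    ∃ (c : C) (p : ℕ → S) (D : ℕ → Set S) (M : ℕ → ℕ), (∀ x ∈ D 0, g x = c) ∧ Antitone D ∧
      Monotone M ∧ ∀ n, p n ∈ V (M n) ∧ N (p n) ≤ M (n + 1) ∧ ∀ a, σ a (p n) ∈ D n ∧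
        ∀ r ∈ D (n + 1), σ a (p n) * r ∈ D n := by
  obtain ⟨w, v, -, hvV, hw, hvw⟩ := exists_common_idempotent_image
    (K := Ultrafilter S) (A := A) Ultrafilter.continuous_mul_left (ultraHull W) (ultraHull V)
    (isClosed_ultraHull W) (ultraHull_nonempty hWa hWn) (isClosed_ultraHull V)
    (ultraHull_nonempty hVa hVn) (ultraHull_mul_mem hWW) (ultraHull_mul_mem hWV)
    (ultraHull_mul_mem hVW) (ultraHull_mul_mem hVV) (fun a U => U.map (σ a))
    (fun a U U' => ultrafilter_map_mul (σ a) (hσ a) U U')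
    (fun a U hU m => by
      rw [Ultrafilter.mem_map]
      filter_upwards [hU m] with x hx using hσV a m x hx)
    (fun a U hU => by
      refine Ultrafilter.coe_inj.mp ?_
      rw [Ultrafilter.coe_map]
      have : Filter.map (σ a) (U : Filter S) = Filter.map id (U : Filter S) :=
        Filter.map_congr (by filter_upwards [hU 0] with x hx using hσW a x hx)
      rw [this, Filter.map_id])
  have step : ∀ t : {D : Set S // D ∈ w} × ℕ, ∃ (p : S) (t' : {D : Set S // D ∈ w} × ℕ),
      p ∈ V t.2 ∧ t'.1.1 ⊆ t.1.1 ∧ t.2 ≤ t'.2 ∧ N p ≤ t'.2 ∧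
      ∀ a, σ a p ∈ t.1.1 ∧ ∀ r ∈ t'.1.1, σ a p * r ∈ t.1.1 := by
    rintro ⟨⟨D, hD⟩, m⟩
    have h1 : ∀ᶠ x in (w : Filter S), x ∈ D ∧ ∀ᶠ r in (w : Filter S), x * r ∈ D := by
      refine Filter.Eventually.and hD ?_
      have : ∀ᶠ x in ((w * w : Ultrafilter S) : Filter S), x ∈ D := by rw [hw]; exact hD
      rwa [Ultrafilter.eventually_mul] at this
    have h2 : ∀ᶠ p in (v : Filter S), ∀ a, σ a p ∈ D ∧
        ∀ᶠ r in (w : Filter S), σ a p * r ∈ D := by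
      rw [Filter.eventually_all]
      intro a
      have h : ∀ᶠ x in ((v.map (σ a) : Ultrafilter S) : Filter S),
          x ∈ D ∧ ∀ᶠ r in (w : Filter S), x * r ∈ D := by
        rw [hvw a]
        exact h1
      rwa [Ultrafilter.coe_map, Filter.eventually_map] at h
    obtain ⟨p, hp, hpV⟩ := (h2.and (hvV m)).exists
    refine ⟨p, ⟨⟨D ∩ {r | ∀ a, σ a p * r ∈ D}, Filter.inter_mem hD ?_⟩, max m (N p)⟩, hpV,
      Set.inter_subset_left, le_max_left _ _, le_max_right _ _, fun a => ⟨(hp a).1, ?_⟩⟩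
    · exact Filter.eventually_all.2 fun a => (hp a).2
    · exact fun r hr => hr.2 a
  obtain ⟨c, hcw⟩ : ∃ c, g ⁻¹' {c} ∈ w := by
    have : (⋃ c ∈ (Set.univ : Set C), g ⁻¹' {c}) ∈ w :=
      Filter.mem_of_superset Filter.univ_mem fun x _ => by simp
    simpa using (Ultrafilter.finite_biUnion_mem_iff Set.finite_univ).1 this
  choose P T hT using step
  let t : ℕ → {D : Set S // D ∈ w} × ℕ := fun n => T^[n] ⟨⟨_, hcw⟩, 0⟩
  have ht : ∀ n, t (n + 1) = T (t n) := fun n => Function.iterate_succ_apply' _ _ _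
  refine ⟨c, fun n => P (t n), fun n => (t n).1.1, fun n => (t n).2, fun x hx => hx,
    antitone_nat_of_succ_le fun n => ?_, monotone_nat_of_le_succ fun n => ?_, fun n => ?_⟩
  · rw [ht]
    exact (hT (t n)).2.1
  · rw [ht]
    exact (hT (t n)).2.2.1
  · beta_reduce
    rw [ht]
    exact ⟨(hT (t n)).1, (hT (t n)).2.2.2⟩

end UltrafilterSemigroup

section LocatedWords

variable {A B : Type*}

theorem pun_assoc (p q r : ℕ → Option B) : pun (pun p q) r = pun p (pun q r) := by
  funext n
  unfold pun
  cases p n <;> rfl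

/-- Partial functions form a semigroup under left-biased union. -/
@[reducible] def punSemigroup (B : Type*) : Semigroup (ℕ → Option B) where
  mul := pun
  mul_assoc := pun_assoc

/-- Union of a list of partial functions, earlier entries taking precedence. -/
def listUnion (l : List (ℕ → Option B)) : ℕ → Option B := l.foldr pun emptyW

theorem pun_emptyW (p : ℕ → Option B) : pun p emptyW = p := by
  funext n
  unfold pun emptyW
  cases p n <;> rfl

theorem listUnion_append (l l' : List (ℕ → Option B)) :
    listUnion (l ++ l') = pun (listUnion l) (listUnion l') := by
  induction l with
  | nil => rfl
  | cons p l ih =>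
    change pun p (listUnion (l ++ l')) = pun (pun p (listUnion l)) _
    rw [ih, pun_assoc]

theorem famUnion_eq_listUnion {k : ℕ} (g : Fin k → ℕ → Option B) :
    famUnion g = listUnion (List.ofFn g) := by
  have key : ∀ (l : List (ℕ → Option B)) (n : ℕ),
      ((l.map fun p => p n).filterMap id).head? = listUnion l n := by
    intro l n
    induction l with
    | nil => rfl
    | cons p l ih =>
      change _ = pun p (listUnion l) n
      unfold pun
      rw [← ih, List.map_cons, List.filterMap_cons]
      cases h : p n <;> simp
  funext n
  rw [← key, List.map_ofFn]
  rfl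

theorem mem_dom_pun {p q : ℕ → Option B} {n : ℕ} :
    n ∈ dom (pun p q) ↔ n ∈ dom p ∨ n ∈ dom q := by
  simp only [dom, pun, Set.mem_ofPred_eq]
  cases p n <;> simp

theorem mem_dom_listUnion {l : List (ℕ → Option B)} {n : ℕ} :
    n ∈ dom (listUnion l) ↔ ∃ p ∈ l, n ∈ dom p := by
  induction l with
  | nil => simp [listUnion, dom, emptyW]
  | cons p l ih =>
    change n ∈ dom (pun p (listUnion l)) ↔ _
    simp [mem_dom_pun, ih]

theorem dom_substV (p : ℕ → Option (Option A)) (a : Option A) : dom (substV p a) = dom p := by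
  ext n
  simp [dom, substV]

theorem substV_pun (p q : ℕ → Option (Option A)) (a : Option A) :
    substV (pun p q) a = pun (substV p a) (substV q a) := by
  funext n
  simp only [substV, pun]
  cases p n <;> rfl

theorem substV_substV (p : ℕ → Option (Option A)) (a b : Option A) :
    substV (substV p a) b = substV p (a.elim b some) := by
  funext n
  unfold substV
  rcases p n with _ | _ | _ <;> rfl

theorem substA_pun (p q : ℕ → Option (Option A)) (a : A) :
    substA (pun p q) a = pun (substA p a) (substA q a) := by
  funext n
  simp only [substA, pun]
  cases p n <;> rfl

theorem substA_substV (p : ℕ → Option (Option A)) (a b : A) :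
    substA (substV p (some a)) b = substA p a := by
  funext n
  unfold substA substV
  rcases p n with _ | _ | _ <;> rfl

/-- The word `p₀[a₀] ∪ ⋯ ∪ p_k[a_k]` described by the list of pairs `(pᵢ, aᵢ)`. -/
def listWord (l : List ((ℕ → Option (Option A)) × Option A)) : ℕ → Option (Option A) :=
  listUnion (l.map fun t => substV t.1 t.2)

theorem listWord_append (l l' : List ((ℕ → Option (Option A)) × Option A)) :
    listWord (l ++ l') = pun (listWord l) (listWord l') := by
  rw [listWord, List.map_append, listUnion_append]
  rfl

theorem listWord_cons (t : (ℕ → Option (Option A)) × Option A)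
    (l : List ((ℕ → Option (Option A)) × Option A)) :
    listWord (t :: l) = pun (substV t.1 t.2) (listWord l) := rfl

theorem substV_listWord (l : List ((ℕ → Option (Option A)) × Option A)) (a : Option A) :
    substV (listWord l) a = listWord (l.map fun t => (t.1, t.2.elim a some)) := by
  induction l with
  | nil => rfl
  | cons t l ih => rw [List.map_cons, listWord_cons, listWord_cons, substV_pun, ih, substV_substV]

/-- The list describes a combination of members of `X` with domain above `m`. -/
def IsBlockList (X : Set (ℕ → Option (Option A))) (m : ℕ)
    (l : List ((ℕ → Option (Option A)) × Option A)) : Prop :=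
  l ≠ [] ∧ (∀ t ∈ l, t.1 ∈ X ∧ domAbove t.1 m) ∧ l.Pairwise fun s t => blt s.1 t.1

/-- Combinations of members of `X` with domain above `m`, using letters only. -/
def letterComb (X : Set (ℕ → Option (Option A))) (m : ℕ) : Set (ℕ → Option (Option A)) :=
  listWord '' {l | IsBlockList X m l ∧ ∀ t ∈ l, t.2 ≠ none}

/-- Combinations of members of `X` with domain above `m`, using the variable at least once. -/
def varComb (X : Set (ℕ → Option (Option A))) (m : ℕ) : Set (ℕ → Option (Option A)) :=
  listWord '' {l | IsBlockList X m l ∧ ∃ t ∈ l, t.2 = none}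

variable {X : Set (ℕ → Option (Option A))}

theorem IsBlockList.mono {m n : ℕ} (h : m ≤ n) {l : List ((ℕ → Option (Option A)) × Option A)}
    (hl : IsBlockList X n l) : IsBlockList X m l :=
  ⟨hl.1, fun t ht => ⟨(hl.2.1 t ht).1, fun k hk => h.trans ((hl.2.1 t ht).2 k hk)⟩, hl.2.2⟩

theorem letterComb_antitone : Antitone (letterComb X) := by
  rintro m n h _ ⟨l, hl, rfl⟩
  exact ⟨l, ⟨hl.1.mono h, hl.2⟩, rfl⟩

theorem varComb_antitone : Antitone (varComb X) := by
  rintro m n h _ ⟨l, hl, rfl⟩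
  exact ⟨l, ⟨hl.1.mono h, hl.2⟩, rfl⟩

theorem IsBlockSeq.exists_domAbove (hX : IsBlockSeq X) (hXinf : X.Infinite) (m : ℕ) :
    ∃ p ∈ X, domAbove p m := by
  by_contra! hcon
  have h : ∀ p : X, ∃ n ∈ dom p.1, n < m := fun p => by
    simpa [domAbove] using hcon p.1 p.2
  choose n hn hnm using h
  have hinj : Function.Injective fun p : X => (⟨n p, hnm p⟩ : Fin m) := by
    intro p q hpq
    have hpq : n p = n q := by simpa using hpq
    rcases hX.2 p.1 p.2 q.1 q.2 with h | h | h
    · exact Subtype.ext h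
    · exact absurd (h _ (hn p) _ (hn q)) (by omega)
    · exact absurd (h _ (hn q) _ (hn p)) (by omega)
  have := hXinf.to_subtype
  exact not_injective_infinite_finite _ hinj

theorem exists_isBlockList_append (hX : IsBlockSeq X) {m : ℕ}
    {l : List ((ℕ → Option (Option A)) × Option A)} (hl : IsBlockList X m l) :
    ∃ n, ∀ l', IsBlockList X n l' → IsBlockList X m (l ++ l') := by
  have hfin : (⋃ t ∈ {t | t ∈ l}, dom t.1).Finite :=
    (List.finite_toSet l).biUnion fun t ht => (hX.1 _ (hl.2.1 t ht).1).1.1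
  obtain ⟨N, hN⟩ := hfin.bddAbove
  refine ⟨max m (N + 1), fun l' hl' => ⟨by simp [hl.1], fun t ht => ?_, ?_⟩⟩
  · rcases List.mem_append.1 ht with ht | ht
    · exact hl.2.1 t ht
    · exact (hl'.mono (le_max_left _ _)).2.1 t ht
  · refine List.pairwise_append.2 ⟨hl.2.2, hl'.2.2, fun s hs t ht i hi j hj => ?_⟩
    have h1 : i ≤ N := hN (Set.mem_biUnion (show s ∈ {t | t ∈ l} from hs) hi)
    have h2 := (hl'.2.1 t ht).2 j hj
    omega

theorem varComb_subset_combV (m : ℕ) : varComb X m ⊆ combV X := by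
  rintro _ ⟨l, ⟨⟨hne, hlX, hlp⟩, t, ht, htn⟩, rfl⟩
  obtain ⟨k, hk⟩ : ∃ k, l.length = k + 1 :=
    Nat.exists_eq_succ_of_ne_zero fun h => hne (List.length_eq_zero_iff.1 h)
  obtain ⟨F, rfl⟩ : ∃ F : Fin (k + 1) → (ℕ → Option (Option A)) × Option A, l = List.ofFn F :=
    ⟨fun i => l.get (i.cast hk.symm), by
      refine List.ext_getElem (by rw [List.length_ofFn, hk]) fun n h1 h2 => ?_
      rw [List.getElem_ofFn]
      rfl⟩
  rw [List.pairwise_ofFn] at hlp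
  obtain ⟨i, rfl⟩ := List.mem_ofFn.1 ht
  refine ⟨k, fun i => (F i).1, fun i => (F i).2,
    fun i => (hlX _ (List.mem_ofFn.2 ⟨i, rfl⟩)).1, fun i j hij => hlp hij, ⟨i, htn⟩, ?_⟩
  rw [famUnion_eq_listUnion, listWord, List.map_ofFn]
  rfl

theorem isLVW_of_mem_varComb (hX : IsBlockSeq X) {m : ℕ} {p : ℕ → Option (Option A)}
    (hp : p ∈ varComb X m) : IsLVW p ∧ domAbove p m := by
  obtain ⟨l, ⟨⟨hne, hlX, hlp⟩, hv⟩, rfl⟩ := hp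
  have hdom : dom (listWord l) = ⋃ t ∈ {t | t ∈ l}, dom t.1 := by
    ext n
    simp [listWord, mem_dom_listUnion, dom_substV]
  have hstar : ∃ n, listWord l n = some none := by
    clear hdom hne
    obtain ⟨t, ht, htn⟩ := hv
    induction l with
    | nil => simp at ht
    | cons s l ih =>
      rw [List.pairwise_cons] at hlp
      rcases List.mem_cons.1 ht with rfl | ht'
      · obtain ⟨n, hn⟩ := (hX.1 _ (hlX t ht).1).2
        exact ⟨n, by simp [listWord_cons, pun, substV, hn, htn]⟩
      · obtain ⟨n, hn⟩ := ih (fun t ht => hlX t (List.mem_cons_of_mem _ ht)) hlp.2 ht'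
        refine ⟨n, ?_⟩
        have hns : n ∉ dom s.1 := by
          intro hns
          have hnl : n ∈ dom (listWord l) := by simp [dom, hn]
          rw [listWord, mem_dom_listUnion] at hnl
          obtain ⟨q, hq, hnq⟩ := hnl
          obtain ⟨u, hu, rfl⟩ := List.mem_map.1 hq
          rw [dom_substV] at hnq
          exact lt_irrefl n (hlp.1 u hu n hns n hnq)
        have hns : s.1 n = none := by simpa [dom] using hns
        simp [listWord_cons, pun, substV, hns, hn]
  refine ⟨⟨⟨?_, ?_⟩, hstar⟩, ?_⟩
  · rw [hdom]
    exact (List.finite_toSet l).biUnion fun t ht => (hX.1 _ (hlX t ht).1).1.1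
  · obtain ⟨n, hn⟩ := hstar
    exact ⟨n, by simp [dom, hn]⟩
  · intro n hn
    rw [hdom] at hn
    simp only [Set.mem_iUnion] at hn
    obtain ⟨t, ht, hnt⟩ := hn
    exact (hlX t ht).2 n hnt

theorem substV_mem_letterComb (a : A) {m : ℕ} {p : ℕ → Option (Option A)}
    (hp : p ∈ varComb X m) : substV p (some a) ∈ letterComb X m := by
  obtain ⟨l, ⟨⟨hne, hlX, hlp⟩, -⟩, rfl⟩ := hp
  refine ⟨_, ⟨⟨?_, ?_, ?_⟩, ?_⟩, (substV_listWord l (some a)).symm⟩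
  · simpa using hne
  · intro t ht
    obtain ⟨s, hs, rfl⟩ := List.mem_map.1 ht
    exact hlX s hs
  · rw [List.pairwise_map]
    exact hlp
  · intro t ht
    obtain ⟨s, -, rfl⟩ := List.mem_map.1 ht
    cases s.2 <;> simp

theorem substV_eq_of_mem_letterComb (a : A) {m : ℕ} {p : ℕ → Option (Option A)}
    (hp : p ∈ letterComb X m) : substV p (some a) = p := by
  obtain ⟨l, ⟨-, hl⟩, rfl⟩ := hp
  rw [substV_listWord]
  congr 1
  conv_rhs => rw [← List.map_id l]
  refine List.map_congr_left fun t ht => ?_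
  obtain ⟨p, _ | b⟩ := t
  · exact absurd rfl (hl _ ht)
  · rfl

end LocatedWords

/-- Strong Carlson's theorem for located words: for every infinite block sequence
`X ⊆ FIN_{A⋆}` and coloring `f : [X]_A → C`, there is an infinite block sequence
`Y ⊆ [X]_{A⋆}` such that `[Y]_A` is `f`-homogeneous. -/
theorem strong_carlson_located_words {A C : Type*} [Fintype A] [Nonempty A] [Fintype C]
    (X : Set (ℕ → Option (Option A))) (hX : IsBlockSeq X) (hXinf : X.Infinite)
    (f : (ℕ → Option A) → C) :
    ∃ Y : Set (ℕ → Option (Option A)), Y ⊆ combV X ∧ IsBlockSeq Y ∧ Y.Infinite ∧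
      ∃ c : C, ∀ q ∈ combA Y, f q = c := by
  obtain ⟨a₀⟩ := ‹Nonempty A›
  let := punSemigroup (Option A)
  have hne := hX.exists_domAbove hXinf
  have hmul : ∀ (P Q R : List ((ℕ → Option (Option A)) × Option A) → Prop),
      (∀ l l', P l → Q l' → R (l ++ l')) → ∀ m, ∀ p ∈ listWord '' {l | IsBlockList X m l ∧ P l},
      ∃ n, ∀ q ∈ listWord '' {l | IsBlockList X n l ∧ Q l},
        p * q ∈ listWord '' {l | IsBlockList X m l ∧ R l} := by
    rintro P Q R h m _ ⟨l, hl, rfl⟩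
    obtain ⟨n, hn⟩ := exists_isBlockList_append hX hl.1
    refine ⟨n, ?_⟩
    rintro _ ⟨l', hl', rfl⟩
    exact ⟨l ++ l', ⟨hn l' hl'.1, h l l' hl.2 hl'.2⟩, listWord_append l l'⟩
  have hsingle : ∀ m (b : Option A), ∃ p, IsBlockList X m [(p, b)] := fun m b => by
    obtain ⟨p, hp, hpm⟩ := hne m
    exact ⟨p, by simp, by simpa using ⟨hp, hpm⟩, by simp⟩
  have hbound : ∀ p : ℕ → Option (Option A), ∃ N : ℕ, IsLVW p → domBelow p N := fun p => by
    by_cases hp : IsLVW p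
    · obtain ⟨N, hN⟩ := hp.1.1.bddAbove
      exact ⟨N + 1, fun _ n hn => Nat.lt_succ_of_le (hN hn)⟩
    · exact ⟨0, fun h => absurd h hp⟩
  choose N hN using hbound
  obtain ⟨c, p, D, M, hD0, hD, hM, h⟩ := exists_absorbing_sequence (letterComb X) (varComb X)
    letterComb_antitone varComb_antitone
    (fun m => by
      obtain ⟨p, hp⟩ := hsingle m (some a₀)
      exact ⟨_, _, ⟨hp, by simp⟩, rfl⟩)
    (fun m => by
      obtain ⟨p, hp⟩ := hsingle m none
      exact ⟨_, _, ⟨hp, by simp⟩, rfl⟩)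
    (hmul _ _ _ fun l l' hl hl' t ht => (List.mem_append.1 ht).elim (hl t) (hl' t))
    (hmul _ _ _ fun l l' _ ⟨t, ht, h⟩ => ⟨t, List.mem_append_right l ht, h⟩)
    (hmul _ _ _ fun l l' ⟨t, ht, h⟩ _ => ⟨t, List.mem_append_left l' ht, h⟩)
    (hmul _ _ _ fun l l' ⟨t, ht, h⟩ _ => ⟨t, List.mem_append_left l' ht, h⟩) (fun (a : A) p => substV p (some a))
    (fun a x y => substV_pun x y (some a)) (fun a m x hx => substV_mem_letterComb a hx)
    (fun a x hx => substV_eq_of_mem_letterComb a hx) (fun p => f (substA p a₀)) N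
  have hlvw : ∀ n, IsLVW (p n) := fun n => (isLVW_of_mem_varComb hX (h n).1).1
  have hblt : ∀ i j, i < j → blt (p i) (p j) := fun i j hij x hx y hy => by
    have h1 := hN (p i) (hlvw i) x hx
    have h2 := (isLVW_of_mem_varComb hX (h j).1).2 y hy
    have h3 := (h i).2.1
    have h4 : M (i + 1) ≤ M j := hM hij
    omega
  have hlt : ∀ i j, blt (p i) (p j) → i < j := fun i j hij => by
    by_contra! hji
    obtain ⟨x, hx⟩ := (hlvw i).1.2
    obtain ⟨y, hy⟩ := (hlvw j).1.2
    have h1 := hij x hx y hy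
    rcases hji.eq_or_lt with rfl | hji
    · exact lt_irrefl x (hij x hx x hx)
    · exact lt_asymm h1 (hblt j i hji y hy x hx)
  have hinj : Function.Injective p := fun i j hij => by
    by_contra hne
    rcases Nat.lt_or_gt_of_ne hne with hlt' | hlt'
    · have := hblt i j hlt'
      rw [hij] at this
      exact lt_irrefl _ (hlt _ _ this)
    · have := hblt j i hlt'
      rw [hij] at this
      exact lt_irrefl _ (hlt _ _ this)
  have hlist : ∀ (l : List (ℕ × A)) (n : ℕ), l ≠ [] → (∀ t ∈ l, n ≤ t.1) →
      l.Pairwise (fun s t => s.1 < t.1) →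
      listUnion (l.map fun t => substV (p t.1) (some t.2)) ∈ D n := by
    intro l
    induction l with
    | nil => simp
    | cons t l ih =>
      intro n _ hn hp
      rw [List.pairwise_cons] at hp
      apply hD (hn t (by simp))
      by_cases hl : l = []
      · subst hl
        change pun _ emptyW ∈ _
        rw [pun_emptyW]
        exact ((h t.1).2.2 t.2).1
      · exact ((h t.1).2.2 t.2).2 _ (ih (t.1 + 1) hl hp.1 hp.2)
  have hsubst : ∀ l : List (ℕ × A),
      substA (listUnion (l.map fun t => substV (p t.1) (some t.2))) a₀ =
        listUnion (l.map fun t => substA (p t.1) t.2) := by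
    intro l
    induction l with
    | nil => rfl
    | cons t l ih =>
      change substA (pun _ _) a₀ = pun _ _
      rw [substA_pun, substA_substV]
      exact congrArg _ ih
  refine ⟨Set.range p, ?_, ⟨?_, ?_⟩, Set.infinite_range_of_injective hinj, c, ?_⟩
  · rintro _ ⟨n, rfl⟩
    exact varComb_subset_combV _ (h n).1
  · rintro _ ⟨n, rfl⟩
    exact hlvw n
  · rintro _ ⟨i, rfl⟩ _ ⟨j, rfl⟩
    rcases lt_trichotomy i j with hij | rfl | hij
    · exact Or.inr (Or.inl (hblt i j hij))
    · exact Or.inl rfl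
    · exact Or.inr (Or.inr (hblt j i hij))
  · rintro _ ⟨k, q, a, hq, hqb, rfl⟩
    choose j hj using hq
    obtain rfl : q = fun i => p (j i) := funext fun i => (hj i).symm
    have hmem := hlist (List.ofFn fun i => (j i, a i)) 0 (by simp) (by simp) (by
      rw [List.pairwise_ofFn]
      exact fun i i' hii => hlt _ _ (hqb i i' hii))
    have := hD0 _ hmem
    rw [hsubst, List.map_ofFn] at this
    rw [famUnion_eq_listUnion]
    exact this

end Carlson
end

section
/- Let (w_n)_{n∈ℕ} be an infinite sequence of variable words over a finite alphabet A and let f : ⟨(w_n)_{n∈ℕ}⟩_A → C be a coloring into a finite set C. Then there exists an infinite sequence of variable words (u_n)_{n∈ℕ} over A such that ⟨(u_n)_{n∈ℕ}⟩_A ⊆ ⟨(w_n)_{n∈ℕ}⟩_A and ⟨(u_n)_{n∈ℕ}⟩_A is f-homogeneous. -/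
namespace Carlson

section RightTopologicalSemigroup

variable {X : Type*} [Semigroup X] [TopologicalSpace X] [CompactSpace X]

/-- A nonempty closed subsemigroup `T` of a compact right topological semigroup contains a
nonempty closed left ideal of `T` that is minimal among such. -/
theorem exists_minimal_closed_leftIdeal {T : Set X} (hT : IsClosed T) (hne : T.Nonempty)
    (hmul : ∀ s ∈ T, ∀ t ∈ T, s * t ∈ T) :
    ∃ L ⊆ T, Minimal
      (· ∈ {L : Set X | IsClosed L ∧ L.Nonempty ∧ ∀ t ∈ T, ∀ l ∈ L, t * l ∈ L}) L := by
  refine zorn_superset_nonempty _ (fun c hcs hc hcne => ?_) T ⟨hT, hne, hmul⟩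
  refine ⟨⋂₀ c, ⟨isClosed_sInter fun L hL => (hcs hL).1, ?_, fun t ht l hl L hL => ?_⟩,
    fun L hL => Set.sInter_subset_of_mem hL⟩
  · exact IsCompact.nonempty_sInter_of_directed_nonempty_isCompact_isClosed
      (hS := hcne.to_subtype) (IsChain.directedOn hc.symm) (fun L hL => (hcs hL).2.1)
      (fun L hL => (hcs hL).1.isCompact) (fun L hL => (hcs hL).1)
  · exact (hcs hL).2.2 t ht l (hl L hL)

variable [T2Space X]

/-- A nonempty closed subsemigroup of a compact Hausdorff right topological semigroup contains a
minimal idempotent. -/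
theorem exists_minimal_idempotent_s2 (hcont : ∀ r : X, Continuous (· * r)) {T : Set X}
    (hT : IsClosed T) (hne : T.Nonempty) (hmul : ∀ s ∈ T, ∀ t ∈ T, s * t ∈ T) :
    ∃ v ∈ T, v * v = v ∧ ∀ e ∈ T, e * e = e → e * v = e → v * e = e → e = v := by
  obtain ⟨L, hLT, hL⟩ := exists_minimal_closed_leftIdeal hT hne hmul
  obtain ⟨hLc, hLne, hLmul⟩ := hL.prop
  obtain ⟨v, hvL, hv⟩ := exists_idempotent_in_compact_subsemigroup hcont L hLne hLc.isCompact
    (fun s hs t ht => hLmul s (hLT hs) t ht)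
  refine ⟨v, hLT hvL, hv, fun e he hee hev hve => ?_⟩
  have heL : e ∈ L := hev ▸ hLmul e he v hvL
  have hTe : (· * e) '' T = L := by
    refine (hL.eq_of_superset ⟨(hcont e).isClosedMap _ hT, hne.image _, ?_⟩ ?_).symm
    · rintro t ht _ ⟨s, hs, rfl⟩
      exact ⟨t * s, hmul t ht s hs, mul_assoc _ _ _⟩
    · rintro _ ⟨s, hs, rfl⟩
      exact hLmul s hs e heL
  obtain ⟨s, -, hs⟩ := hTe.symm ▸ hvL
  calc e = v * e := hve.symm
    _ = s * e * e := by rw [← hs]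
    _ = v := by rw [mul_assoc, hee]; exact hs

/-- If a nonempty closed subsemigroup `I` absorbs the idempotent `v` on both sides, then some
idempotent of `I` lies below `v`. -/
theorem exists_idempotent_below (hcont : ∀ r : X, Continuous (· * r)) {I : Set X}
    (hI : IsClosed I) (hne : I.Nonempty) (hmul : ∀ s ∈ I, ∀ t ∈ I, s * t ∈ I)
    {v : X} (hv : v * v = v) (hIv : ∀ s ∈ I, s * v ∈ I) (hvI : ∀ s ∈ I, v * s ∈ I) :
    ∃ u ∈ I, u * u = u ∧ u * v = u ∧ v * u = u := by
  obtain ⟨_, ⟨s, hs, rfl⟩, hw⟩ := exists_idempotent_in_compact_subsemigroup hcont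
    ((· * v) '' I) (hne.image _) (((hcont v).isClosedMap _ hI).isCompact) (by
      rintro _ ⟨s, hs, rfl⟩ _ ⟨t, ht, rfl⟩
      exact ⟨s * v * t, hmul _ (hIv s hs) t ht, mul_assoc _ _ _⟩)
  beta_reduce at hw
  refine ⟨v * (s * v), hvI _ (hIv s hs), ?_, ?_, ?_⟩
  · calc v * (s * v) * (v * (s * v)) = v * (s * (v * v) * (s * v)) := by
          simp only [mul_assoc]
      _ = v * (s * v) := by rw [hv, hw]
  · rw [mul_assoc, mul_assoc, hv]
  · rw [← mul_assoc, hv]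

end RightTopologicalSemigroup

attribute [local instance] Ultrafilter.semigroup

theorem map_ultrafilter_mul {M N : Type*} [Semigroup M] [Semigroup N] (φ : M →ₙ* N)
    (U V : Ultrafilter M) : (U * V).map φ = U.map φ * V.map φ := by
  apply Ultrafilter.coe_inj.mp
  refine Filter.ext' fun p => ?_
  simp only [Ultrafilter.coe_map, Filter.eventually_map, Ultrafilter.eventually_mul, map_mul]

section GalvinGlazer

variable {M ι : Type*} [Monoid M] [Finite ι] {u v : Ultrafilter M} {σ : ι → M → M}

theorem exists_mem_forall_mem {D s : Set M} (hv : v * v = v) (hσ : ∀ i, u.map (σ i) = v)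
    (hD : D ∈ u) (hs : s ∈ v) :
    ∃ x ∈ D, ∀ i, σ i x ∈ s ∧ ∀ᶠ m in v, σ i x * m ∈ s := by
  have hs' : ∀ᶠ m in (v : Filter M), m ∈ s ∧ ∀ᶠ m' in v, m * m' ∈ s := by
    refine Filter.Eventually.and hs ?_
    rw [← Ultrafilter.eventually_mul, hv]
    exact hs
  have hu : ∀ᶠ x in (u : Filter M), ∀ i, σ i x ∈ s ∧ ∀ᶠ m in v, σ i x * m ∈ s := by
    refine Filter.eventually_all.2 fun i => ?_
    rw [← hσ i] at hs'
    have := Filter.eventually_map.1 hs'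
    rwa [hσ i] at this
  obtain ⟨x, hxD, hx⟩ := (Filter.Eventually.and hD hu).exists
  exact ⟨x, hxD, hx⟩

/-- If all substitutions `σ i` map `u` to the idempotent ultrafilter `v`, then inside any
`u`-large set `D` there is a sequence all of whose increasing substituted products lie in
a prescribed `v`-large set `s`. -/
theorem exists_seq_forall_prod_mem {D s : Set M} (hv : v * v = v) (hσ : ∀ i, u.map (σ i) = v)
    (hD : D ∈ u) (hs : s ∈ v) :
    ∃ x : ℕ → M, (∀ n, x n ∈ D) ∧ ∀ (k : ℕ) (j : Fin (k + 1) → ℕ) (a : Fin (k + 1) → ι),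
      StrictMono j → (List.ofFn fun i => σ (a i) (x (j i))).prod ∈ s := by
  choose g hgD hgs using fun t : {t : Set M // t ∈ v} =>
    exists_mem_forall_mem hv hσ hD t.property
  let next : {t : Set M // t ∈ v} → {t : Set M // t ∈ v} := fun t =>
    ⟨t.1 ∩ {m | ∀ i, σ i (g t) * m ∈ t.1},
      Filter.inter_mem t.2 (Filter.eventually_all.2 fun i => (hgs t i).2)⟩
  let S : ℕ → {t : Set M // t ∈ v} := fun n => next^[n] ⟨s, hs⟩
  have hS : ∀ n, S (n + 1) = next (S n) := fun n => Function.iterate_succ_apply' next n _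
  have hanti : Antitone fun n => (S n).1 := antitone_nat_of_succ_le fun n => by
    rw [hS]
    exact Set.inter_subset_left
  refine ⟨fun n => g (S n), fun n => hgD _, fun k j a hj => ?_⟩
  suffices h : (List.ofFn fun i => σ (a i) (g (S (j i)))).prod ∈ (S (j 0)).1 from
    hanti (Nat.zero_le _) h
  induction k with
  | zero => simpa using (hgs (S (j 0)) (a 0)).1
  | succ k ih =>
    rw [List.ofFn_succ, List.prod_cons]
    have htail := hanti (Nat.succ_le_of_lt (hj (Fin.succ_pos 0)))
      (ih (fun i => j i.succ) (fun i => a i.succ) (hj.comp (Fin.strictMono_succ)))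
    simp only [hS, Nat.succ_eq_add_one] at htail
    exact htail.2 (a 0)

end GalvinGlazer

section LocatedWords

variable {A : Type*}

/-- Formal products of blocks `w_j[x]` with strictly increasing indices `j ≥ n`; the block
`w_j[x]` is represented by the pair `(j, x)`. -/
def increasingFrom (A : Type*) (n : ℕ) : Set (FreeMonoid (ℕ × Option A)) :=
  {m | m.toList ≠ [] ∧ m.toList.Pairwise (fun p q => p.1 < q.1) ∧ ∀ p ∈ m.toList, n ≤ p.1}

/-- Formal products in which the variable does not occur. -/
def constantWords (A : Type*) : Set (FreeMonoid (ℕ × Option A)) :=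
  {m | ∀ p ∈ m.toList, p.2 ≠ none}

/-- Formal products in which the variable occurs. -/
def variableWords (A : Type*) : Set (FreeMonoid (ℕ × Option A)) :=
  {m | ∃ p ∈ m.toList, p.2 = none}

/-- Substitution of the letter `a` for the variable in a formal product of blocks. -/
def substBlocks (a : A) : FreeMonoid (ℕ × Option A) →* FreeMonoid (ℕ × Option A) :=
  FreeMonoid.map fun p => (p.1, some (p.2.getD a))

/-- Ultrafilters of formal products with increasing indices tending to infinity. -/
def tailUltrafilters (A : Type*) : Set (Ultrafilter (FreeMonoid (ℕ × Option A))) :=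
  {U | ∀ n, increasingFrom A n ∈ U}

theorem isClosed_tailUltrafilters_inter (s : Set (FreeMonoid (ℕ × Option A))) :
    IsClosed (tailUltrafilters A ∩ {U | s ∈ U}) := by
  refine IsClosed.inter ?_ (ultrafilter_isClosed_basic s)
  simp only [tailUltrafilters, Set.ofPred_forall]
  exact isClosed_iInter fun n => ultrafilter_isClosed_basic _

theorem exists_tailUltrafilter (x : Option A) :
    ∃ U ∈ tailUltrafilters A, {m | ∀ p ∈ m.toList, p.2 = x} ∩ {m | m.toList ≠ []} ∈ U := by
  refine ⟨(Filter.hyperfilter ℕ).map fun n => FreeMonoid.of (n, x), fun n => ?_, ?_⟩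
  · have h : ∀ᶠ k in Filter.hyperfilter ℕ, n ≤ k :=
      Nat.hyperfilter_le_atTop (Filter.eventually_ge_atTop n)
    rw [Ultrafilter.mem_map]
    filter_upwards [h] with k hk
    simpa [increasingFrom] using hk
  · rw [Ultrafilter.mem_map]
    refine Filter.univ_mem' fun k => ?_
    simp

theorem mul_mem_tailUltrafilters {U V : Ultrafilter (FreeMonoid (ℕ × Option A))}
    (hU : U ∈ tailUltrafilters A) (hV : V ∈ tailUltrafilters A) : U * V ∈ tailUltrafilters A := by
  intro n
  refine (Ultrafilter.eventually_mul U V (· ∈ increasingFrom A n)).2 ?_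
  filter_upwards [hU n] with m hm
  obtain ⟨N, hN⟩ : ∃ N, ∀ p ∈ m.toList, p.1 < N := by
    obtain ⟨N, hN⟩ := (m.toList.map Prod.fst).toFinset.bddAbove
    exact ⟨N + 1, fun p hp => Nat.lt_succ_of_le (hN (by simpa using ⟨p.2, hp⟩))⟩
  filter_upwards [hV n, hV N] with m' hm' hm'N
  refine ⟨by simp [hm.1], ?_, ?_⟩
  · rw [FreeMonoid.toList_mul, List.pairwise_append]
    exact ⟨hm.2.1, hm'.2.1, fun p hp q hq => (hN p hp).trans_le (hm'N.2.2 q hq)⟩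
  · intro p hp
    rw [FreeMonoid.toList_mul, List.mem_append] at hp
    exact hp.elim (hm.2.2 p) (hm'.2.2 p)

theorem constantWords_mem_mul {U V : Ultrafilter (FreeMonoid (ℕ × Option A))}
    (hU : constantWords A ∈ U) (hV : constantWords A ∈ V) : constantWords A ∈ U * V := by
  refine (Ultrafilter.eventually_mul U V (· ∈ constantWords A)).2 ?_
  filter_upwards [hU] with m hm
  filter_upwards [hV] with m' hm' p hp
  rw [FreeMonoid.toList_mul, List.mem_append] at hp
  exact hp.elim (hm p) (hm' p)

theorem variableWords_mem_mul_right {U V : Ultrafilter (FreeMonoid (ℕ × Option A))}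
    (hU : variableWords A ∈ U) : variableWords A ∈ U * V := by
  refine (Ultrafilter.eventually_mul U V (· ∈ variableWords A)).2 ?_
  filter_upwards [hU] with m ⟨p, hp, hp'⟩
  exact Filter.Eventually.of_forall fun m' => ⟨p, by simp [hp], hp'⟩

theorem variableWords_mem_mul_left {U V : Ultrafilter (FreeMonoid (ℕ × Option A))}
    (hV : variableWords A ∈ V) : variableWords A ∈ U * V := by
  refine (Ultrafilter.eventually_mul U V (· ∈ variableWords A)).2 ?_
  refine Filter.Eventually.of_forall fun m => ?_
  filter_upwards [hV] with m' ⟨p, hp, hp'⟩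
  exact ⟨p, by simp [hp], hp'⟩

theorem map_substBlocks_mem_tailUltrafilters (a : A)
    {U : Ultrafilter (FreeMonoid (ℕ × Option A))} (hU : U ∈ tailUltrafilters A) :
    U.map (substBlocks a) ∈ tailUltrafilters A := by
  intro n
  rw [Ultrafilter.mem_map]
  filter_upwards [hU n] with m hm
  refine ⟨by simpa [substBlocks, FreeMonoid.toList_map] using hm.1, ?_, ?_⟩
  · rw [substBlocks, FreeMonoid.toList_map, List.pairwise_map]
    exact hm.2.1
  · rw [substBlocks, FreeMonoid.toList_map, List.forall_mem_map]
    exact hm.2.2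

theorem substBlocks_mem_constantWords (a : A) (m : FreeMonoid (ℕ × Option A)) :
    substBlocks a m ∈ constantWords A := by
  simp [substBlocks, constantWords, FreeMonoid.toList_map]

theorem substBlocks_eq_self (a : A) {m : FreeMonoid (ℕ × Option A)} (hm : m ∈ constantWords A) :
    substBlocks a m = m := by
  apply FreeMonoid.toList.injective
  rw [substBlocks, FreeMonoid.toList_map]
  refine (List.map_congr_left fun p hp => ?_).trans (List.map_id _)
  obtain ⟨j, x⟩ := p
  cases x with
  | none => exact absurd rfl (hm _ hp)
  | some b => rfl

theorem map_substBlocks_eq_self (a : A) {U : Ultrafilter (FreeMonoid (ℕ × Option A))}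
    (hU : constantWords A ∈ U) : U.map (substBlocks a) = U := by
  apply Ultrafilter.coe_inj.mp
  rw [Ultrafilter.coe_map]
  refine (Filter.map_congr (m₂ := id) ?_).trans Filter.map_id
  filter_upwards [hU] with m hm
  exact substBlocks_eq_self a hm

/-- There are an idempotent tail ultrafilter `v` of constant words and an ultrafilter `u` of
variable words such that every substitution maps `u` to `v`. -/
theorem exists_ultrafilters_map_substBlocks [Nonempty A] :
    ∃ u v : Ultrafilter (FreeMonoid (ℕ × Option A)), v ∈ tailUltrafilters A ∧ v * v = v ∧
      variableWords A ∈ u ∧ ∀ a : A, u.map (substBlocks a) = v := by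
  obtain ⟨a₀⟩ := ‹Nonempty A›
  have hcont : ∀ V : Ultrafilter (FreeMonoid (ℕ × Option A)), Continuous (· * V) :=
    Ultrafilter.continuous_mul_left
  obtain ⟨v, ⟨hvT, hvA⟩, hv, hmin⟩ := exists_minimal_idempotent_s2 hcont
    (isClosed_tailUltrafilters_inter (constantWords A))
    (by
      obtain ⟨U, hU, hUx⟩ := exists_tailUltrafilter (some a₀)
      exact ⟨U, hU, Filter.mem_of_superset hUx fun m hm p hp => by simp [hm.1 p hp]⟩)
    (fun U hU V hV => ⟨mul_mem_tailUltrafilters hU.1 hV.1, constantWords_mem_mul hU.2 hV.2⟩)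
  obtain ⟨u, ⟨huT, huV⟩, huu, huv, hvu⟩ := exists_idempotent_below hcont
    (isClosed_tailUltrafilters_inter (variableWords A))
    (by
      obtain ⟨U, hU, hUx⟩ := exists_tailUltrafilter (none : Option A)
      refine ⟨U, hU, Filter.mem_of_superset hUx fun m hm => ?_⟩
      obtain ⟨p, hp⟩ := List.exists_mem_of_ne_nil _ hm.2
      exact ⟨p, hp, hm.1 p hp⟩)
    (fun U hU V hV => ⟨mul_mem_tailUltrafilters hU.1 hV.1, variableWords_mem_mul_right hU.2⟩)
    hv
    (fun U hU => ⟨mul_mem_tailUltrafilters hU.1 hvT, variableWords_mem_mul_right hU.2⟩)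
    (fun U hU => ⟨mul_mem_tailUltrafilters hvT hU.1, variableWords_mem_mul_left hU.2⟩)
  refine ⟨u, v, hvT, hv, huV, fun a => ?_⟩
  have hmap := map_ultrafilter_mul (substBlocks a).toMulHom
  have hva := map_substBlocks_eq_self a hvA
  refine hmin _ ⟨map_substBlocks_mem_tailUltrafilters a huT,
    Filter.univ_mem' fun m => substBlocks_mem_constantWords a m⟩ ?_ ?_ ?_
  · exact (hmap u u).symm.trans (congrArg _ huu)
  · nth_rewrite 1 [← hva]
    exact (hmap u v).symm.trans (congrArg _ huv)
  · nth_rewrite 1 [← hva]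
    exact (hmap v u).symm.trans (congrArg _ hvu)

/-- The word `w_{j₀}[x₀] ⋯ w_{j_k}[x_k]` over `A ∪ {⋆}` denoted by a formal product. -/
def evalBlocks (w : ℕ → List (Option A)) (m : FreeMonoid (ℕ × Option A)) : List (Option A) :=
  m.toList.flatMap fun p => (w p.1).map fun y => y.elim p.2 some

/-- The word over `A` denoted by a formal product, with `a₀` substituted for the variable. -/
def evalBlocksAt (w : ℕ → List (Option A)) (a₀ : A) (m : FreeMonoid (ℕ × Option A)) : List A :=
  m.toList.flatMap fun p => substW (w p.1) (p.2.getD a₀)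

theorem isVarWord_evalBlocks {w : ℕ → List (Option A)} (hw : ∀ n, IsVarWord (w n))
    {m : FreeMonoid (ℕ × Option A)} (hm : m ∈ variableWords A) : IsVarWord (evalBlocks w m) := by
  obtain ⟨p, hp, hp'⟩ := hm
  exact List.mem_flatMap.2 ⟨p, hp, List.mem_map.2 ⟨none, hw p.1, hp'⟩⟩

theorem substW_evalBlocks (w : ℕ → List (Option A)) (a₀ a : A)
    (m : FreeMonoid (ℕ × Option A)) :
    substW (evalBlocks w m) a = evalBlocksAt w a₀ (substBlocks a m) := by
  simp only [substW, evalBlocks, evalBlocksAt, substBlocks, FreeMonoid.toList_map,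
    List.map_flatMap, List.flatMap_map, List.map_map]
  refine congrArg (List.flatMap · _) (funext fun p => List.map_congr_left fun y _ => ?_)
  cases y <;> rfl

theorem evalBlocksAt_prod (w : ℕ → List (Option A)) (a₀ : A)
    (l : List (FreeMonoid (ℕ × Option A))) :
    evalBlocksAt w a₀ l.prod = (l.map (evalBlocksAt w a₀)).flatten := by
  induction l with
  | nil => rfl
  | cons m l ih =>
    rw [List.prod_cons, List.map_cons, List.flatten_cons, ← ih]
    simp [evalBlocksAt, FreeMonoid.toList_mul]

theorem evalBlocksAt_mem_extracted (w : ℕ → List (Option A)) (a₀ : A)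
    {m : FreeMonoid (ℕ × Option A)} (hm : m ∈ increasingFrom A 0) :
    evalBlocksAt w a₀ m ∈ extracted w := by
  obtain ⟨hne, hsorted, -⟩ := hm
  obtain ⟨k, g, hg⟩ : ∃ (k : ℕ) (g : Fin (k + 1) → ℕ × Option A), m.toList = List.ofFn g := by
    generalize m.toList = l at hne
    cases l with
    | nil => exact absurd rfl hne
    | cons p l => exact ⟨l.length, _, (List.ofFn_get (p :: l)).symm⟩
  rw [hg, List.pairwise_ofFn] at hsorted
  refine ⟨k, fun i => (g i).1, fun i => (g i).2.getD a₀, fun i j hij => hsorted hij, ?_⟩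
  rw [evalBlocksAt, hg, List.flatMap_def, List.map_ofFn]
  rfl

end LocatedWords

/-- Strong Carlson's theorem for words: for every infinite sequence `(w_n)` of variable
words over `A` and coloring `f : ⟨(w_n)⟩_A → C`, there is an infinite sequence `(u_n)` of
variable words with `⟨(u_n)⟩_A ⊆ ⟨(w_n)⟩_A` such that `⟨(u_n)⟩_A` is `f`-homogeneous. -/
theorem strong_carlson_words {A C : Type*} [Fintype A] [Nonempty A] [Fintype C]
    (w : ℕ → List (Option A)) (hw : ∀ n, IsVarWord (w n)) (f : List A → C) :
    ∃ u : ℕ → List (Option A), (∀ n, IsVarWord (u n)) ∧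
      extracted u ⊆ extracted w ∧ ∃ c : C, ∀ v ∈ extracted u, f v = c := by
  obtain ⟨a₀⟩ := ‹Nonempty A›
  obtain ⟨u, v, hvT, hv, huV, huv⟩ := exists_ultrafilters_map_substBlocks (A := A)
  obtain ⟨c, hc⟩ := (v.map fun m => f (evalBlocksAt w a₀ m)).eq_pure_of_finite
  have hcv : {m | f (evalBlocksAt w a₀ m) = c} ∈ v := by
    have h : {c} ∈ v.map fun m => f (evalBlocksAt w a₀ m) := by
      rw [hc]
      exact Filter.mem_pure.2 rfl
    exact h
  obtain ⟨x, hxV, hx⟩ := exists_seq_forall_prod_mem hv huv huV (Filter.inter_mem hcv (hvT 0))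
  have key : ∀ z ∈ extracted (fun n => evalBlocks w (x n)), ∃ m ∈ increasingFrom A 0,
      f (evalBlocksAt w a₀ m) = c ∧ z = evalBlocksAt w a₀ m := by
    rintro _ ⟨k, j, a, hj, rfl⟩
    refine ⟨_, (hx k j a hj).2, (hx k j a hj).1, ?_⟩
    rw [evalBlocksAt_prod, List.map_ofFn]
    simp only [substW_evalBlocks w a₀]
    rfl
  refine ⟨fun n => evalBlocks w (x n), fun n => isVarWord_evalBlocks hw (hxV n), ?_, c, ?_⟩
  · intro z hz
    obtain ⟨m, hm, -, rfl⟩ := key z hz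
    exact evalBlocksAt_mem_extracted w a₀ hm
  · intro z hz
    obtain ⟨m, -, hm, rfl⟩ := key z hz
    exact hm

end Carlson
end
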